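/- arXiv:1111.2635 — 2 statements merged into one kernel-verified Lean document; each statement's English description precedes it below -/
import Mathlib

section
/- For every x ∈ GL_n(ℍ), x is conjugate in GL_n(ℍ) to conj(xᵀ), the conjugate transpose of x; that is, there exists y ∈ GL_n(ℍ) such that y · x · y⁻¹ = conj(xᵀ). -/
open Quaternion Matrix

section T
open Polynomial
variable {K : Type*} [Field K]

lemma aux_functional (f : K[X]) (hf : f ≠ 0) :
    ∃ l : K[X] →ₗ[K] K, (∀ g, f ∣ g → l g = 0) ∧ ∀ a, ¬ f ∣ a → ∃ b, l (a * b) ≠ 0 := by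
  refine ⟨{ toFun := fun g => (g % f).coeff (f.natDegree - 1)
            map_add' := fun a b => by simp [Polynomial.add_mod]
            map_smul' := fun r a => by
              have : (r • a) % f = r • (a % f) := by
                rw [Polynomial.smul_eq_C_mul, Polynomial.smul_eq_C_mul]
                by_cases hr : r = 0
                · simp [hr]
                rw [Polynomial.mod_def, Polynomial.mod_def, ← Polynomial.smul_eq_C_mul,
                  Polynomial.smul_modByMonic, Polynomial.smul_eq_C_mul]
              simp [this] }, ?_, ?_⟩
  · intro g hg
    simp [(EuclideanDomain.mod_eq_zero).2 hg]
  · intro a ha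
    have hr : a % f ≠ 0 := fun h => ha ((EuclideanDomain.mod_eq_zero).1 h)
    have hd := Polynomial.degree_mod_lt a hf
    have hn : (a % f).natDegree < f.natDegree := Polynomial.natDegree_lt_natDegree hr hd
    refine ⟨X ^ (f.natDegree - 1 - (a % f).natDegree), ?_⟩
    have h1 : (a * X ^ (f.natDegree - 1 - (a % f).natDegree)) % f
        = (a % f) * X ^ (f.natDegree - 1 - (a % f).natDegree) := by
      have h2 : a * X ^ (f.natDegree - 1 - (a % f).natDegree)
         = (a % f) * X ^ (f.natDegree - 1 - (a % f).natDegree)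
          + f * ((a / f) * X ^ (f.natDegree - 1 - (a % f).natDegree)) := by
        have h5 := EuclideanDomain.mod_add_div a f
        generalize (X : K[X]) ^ (f.natDegree - 1 - (a % f).natDegree) = Y
        linear_combination (-Y) * h5
      rw [h2, Polynomial.add_mod, (EuclideanDomain.mod_eq_zero).2 (Dvd.intro _ rfl), add_zero]
      rw [Polynomial.mod_eq_self_iff hf]
      apply Polynomial.degree_lt_degree
      rw [Polynomial.natDegree_mul_X_pow _ hr]
      omega
    simp only [LinearMap.coe_mk, AddHom.coe_mk, h1]
    have h3 : f.natDegree - 1 = (a % f).natDegree + (f.natDegree - 1 - (a % f).natDegree) := by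
      omega
    have h4 := Polynomial.coeff_mul_X_pow (a % f) (f.natDegree - 1 - (a % f).natDegree)
      (a % f).natDegree
    rw [← h3] at h4
    rw [h4]
    simpa using hr

lemma aux_form (f : K[X]) (hf : f ≠ 0) :
    ∃ B : (K[X] ⧸ (K[X] ∙ f)) → (K[X] ⧸ (K[X] ∙ f)) → K,
      (∀ a b c, B (a + b) c = B a c + B b c) ∧ (∀ a b c, B a (b + c) = B a b + B a c) ∧
      (∀ (r : K) a b, B (C r • a) b = r * B a b) ∧ (∀ (r : K) a b, B a (C r • b) = r * B a b) ∧
      (∀ a b, B ((X : K[X]) • a) b = B a ((X : K[X]) • b)) ∧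
      ∀ a, a ≠ 0 → ∃ b, B a b ≠ 0 := by
  obtain ⟨l, h0, h1⟩ := aux_functional f hf
  have key : ∀ g h, f ∣ g - h → l g = l h := fun g h hd => by
    have := h0 _ hd
    rwa [map_sub, sub_eq_zero] at this
  have hB : ∀ a b : K[X], l (Quotient.out (Submodule.Quotient.mk (p := K[X] ∙ f) a) *
      Quotient.out (Submodule.Quotient.mk (p := K[X] ∙ f) b)) = l (a * b) := by
    have ho : ∀ a : K[X], f ∣ (Quotient.out (Submodule.Quotient.mk (p := K[X] ∙ f) a)) - a := by
      intro a
      have : Submodule.Quotient.mk (p := K[X] ∙ f)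
        (Quotient.out (Submodule.Quotient.mk (p := K[X] ∙ f) a))
          = Submodule.Quotient.mk a := Quotient.out_eq _
      rw [Submodule.Quotient.eq] at this
      exact Ideal.mem_span_singleton.1 this
    intro a b
    apply key
    obtain ⟨u, hu⟩ := ho a
    obtain ⟨v, hv⟩ := ho b
    rw [sub_eq_iff_eq_add] at hu hv
    rw [hu, hv]
    exact ⟨u * (f * v + b) + a * v, by ring⟩
  obtain ⟨B, hB⟩ : ∃ B : (K[X] ⧸ (K[X] ∙ f)) → (K[X] ⧸ (K[X] ∙ f)) → K,
      ∀ a b : K[X], B (Submodule.Quotient.mk a) (Submodule.Quotient.mk b) = l (a * b) :=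
    ⟨fun a b => l (Quotient.out a * Quotient.out b), hB⟩
  refine ⟨B, ?_, ?_, ?_, ?_, ?_, ?_⟩
  · intro a b c
    induction a using Submodule.Quotient.induction_on with | _ a
    induction b using Submodule.Quotient.induction_on with | _ b
    induction c using Submodule.Quotient.induction_on with | _ c
    rw [← Submodule.Quotient.mk_add, hB, hB, hB, add_mul, map_add]
  · intro a b c
    induction a using Submodule.Quotient.induction_on with | _ a
    induction b using Submodule.Quotient.induction_on with | _ b
    induction c using Submodule.Quotient.induction_on with | _ c
    rw [← Submodule.Quotient.mk_add, hB, hB, hB, mul_add, map_add]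
  · intro r a b
    induction a using Submodule.Quotient.induction_on with | _ a
    induction b using Submodule.Quotient.induction_on with | _ b
    rw [← Submodule.Quotient.mk_smul, hB, hB, smul_eq_mul, mul_assoc, ← Polynomial.smul_eq_C_mul,
      map_smul, smul_eq_mul]
  · intro r a b
    induction a using Submodule.Quotient.induction_on with | _ a
    induction b using Submodule.Quotient.induction_on with | _ b
    rw [← Submodule.Quotient.mk_smul, hB, hB, smul_eq_mul, mul_left_comm,
      ← Polynomial.smul_eq_C_mul, map_smul, smul_eq_mul]
  · intro a b
    induction a using Submodule.Quotient.induction_on with | _ a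
    induction b using Submodule.Quotient.induction_on with | _ b
    rw [← Submodule.Quotient.mk_smul, ← Submodule.Quotient.mk_smul, hB, hB, smul_eq_mul,
      smul_eq_mul, mul_assoc, mul_left_comm]
  · intro a ha
    induction a using Submodule.Quotient.induction_on with | _ a
    have : ¬ f ∣ a := fun h => ha (by
      rw [Submodule.Quotient.mk_eq_zero]
      exact Ideal.mem_span_singleton.2 h)
    obtain ⟨b, hb⟩ := h1 a this
    exact ⟨Submodule.Quotient.mk b, by rw [hB]; exact hb⟩

open Module in
lemma aux_transpose {m : Type*} [Fintype m] [DecidableEq m] (A : Matrix m m K) :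
    ∃ S : Matrix m m K, S.det ≠ 0 ∧ S * A = Aᵀ * S := by
  obtain ⟨ι, _, p, hp, e, ⟨φ⟩⟩ := Module.equiv_directSum_of_isTorsion
    (Module.AEval.isTorsion_of_finiteDimensional K (m → K) (Matrix.toLin' A))
  classical
  choose B hB1 hB2 hB3 hB4 hB5 hB6 using fun i =>
    aux_form (p i ^ e i) (pow_ne_zero _ (hp i).ne_zero)
  let c : (m → K) → (i : ι) → (K[X] ⧸ (K[X] ∙ (p i ^ e i))) :=
    fun v i => φ (AEval'.of (Matrix.toLin' A) v) i
  have c_add : ∀ v w i, c (v + w) i = c v i + c w i := fun v w i => by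
    simp [c]
  have c_smul : ∀ (r : K) v i, c (r • v) i = (C r : K[X]) • c v i := fun r v i => by
    simp only [c, map_smul]
    rw [← AEval.C_smul, map_smul]
    rfl
  have c_X : ∀ v i, c (A *ᵥ v) i = (X : K[X]) • c v i := fun v i => by
    have := AEval'.X_smul_of (Matrix.toLin' A) v
    simp only [c]
    rw [← Matrix.toLin'_apply, ← this, map_smul]
    rfl
  let F : (m → K) →ₗ[K] (m → K) →ₗ[K] K := LinearMap.mk₂ K (fun v w => ∑ i, B i (c v i) (c w i))
    (fun a b d => by simp only [c_add, hB1, Finset.sum_add_distrib])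
    (fun r a b => by simp only [c_smul, hB3, Finset.mul_sum, smul_eq_mul])
    (fun a b d => by simp only [c_add, hB2, Finset.sum_add_distrib])
    (fun r a b => by simp only [c_smul, hB4, Finset.mul_sum, smul_eq_mul])
  have hF : F.SeparatingLeft := by
    intro v hv
    by_contra hne
    have : ∃ i, c v i ≠ 0 := by
      by_contra! h
      apply hne
      have h2 : φ (AEval'.of (Matrix.toLin' A) v) = 0 := by
        ext i : 1
        exact h i
      simpa using h2
    obtain ⟨i, hi⟩ := this
    obtain ⟨b, hb⟩ := hB6 i _ hi
    have hw := hv ((AEval'.of (Matrix.toLin' A)).symm (φ.symm (DirectSum.of _ i b)))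
    have hz : ∀ j a, B j a 0 = 0 := fun j a => by simpa using hB2 j a 0 0
    simp only [F, LinearMap.mk₂_apply] at hw
    rw [Finset.sum_eq_single i] at hw
    · apply hb
      simpa [c] using hw
    · intro j _ hj
      have : c ((AEval'.of (Matrix.toLin' A)).symm (φ.symm (DirectSum.of _ i b))) j = 0 := by
        simp only [c, LinearEquiv.apply_symm_apply]
        exact DirectSum.of_eq_of_ne _ _ _ hj
      rw [this, hz]
    · simp
  have hself : ∀ v w, F (A *ᵥ v) w = F v (A *ᵥ w) := fun v w => by
    simp only [F, LinearMap.mk₂_apply, c_X, hB5]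
  refine ⟨LinearMap.toMatrix₂' K F, ?_, ?_⟩
  · rw [← LinearMap.separatingLeft_toLinearMap₂'_iff_det_ne_zero]
    simpa using hF
  · have h : F.compl₂ (Matrix.toLin' A) = F.comp (Matrix.toLin' A) := by
      apply LinearMap.ext₂
      intro v w
      simpa using (hself v w).symm
    have h2 := congrArg (LinearMap.toMatrix₂' K) h
    rw [LinearMap.toMatrix₂'_compl₂, LinearMap.toMatrix₂'_comp] at h2
    simpa using h2
end T

section Q

/-- The standard complex `2 × 2` representation of the quaternions. -/
noncomputable def quatRep : ℍ[ℝ] →+* Matrix (Fin 2) (Fin 2) ℂ where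
  toFun q := !![⟨q.re, q.imI⟩, ⟨q.imJ, q.imK⟩; ⟨-q.imJ, q.imK⟩, ⟨q.re, -q.imI⟩]
  map_one' := by
    ext i j; fin_cases i <;> fin_cases j <;> simp [Complex.ext_iff]
  map_zero' := by
    ext i j; fin_cases i <;> fin_cases j <;> simp [Complex.ext_iff]
  map_add' p q := by
    ext i j; fin_cases i <;> fin_cases j <;> simp [Complex.ext_iff] <;> ring
  map_mul' p q := by
    ext i j; fin_cases i <;> fin_cases j <;>
      simp [Complex.ext_iff, Matrix.mul_apply, Fin.sum_univ_two] <;> constructor <;> ring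

/-- A real-linear left inverse of `quatRep`, killing `I • quatRep q`. -/
noncomputable def quatProj (m : Matrix (Fin 2) (Fin 2) ℂ) : ℍ[ℝ] :=
  ⟨((m 0 0).re + (m 1 1).re) / 2, ((m 0 0).im - (m 1 1).im) / 2,
    ((m 0 1).re - (m 1 0).re) / 2, ((m 0 1).im + (m 1 0).im) / 2⟩

lemma quatProj_rep (p q : ℍ[ℝ]) : quatProj (quatRep p + Complex.I • quatRep q) = p := by
  ext <;> simp [quatProj, quatRep] <;> ring

lemma quatProj_rep' (p q : ℍ[ℝ]) :
    quatProj ((-Complex.I) • (quatRep p + Complex.I • quatRep q)) = q := by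
  ext <;> simp [quatProj, quatRep] <;> ring

lemma quatRep_dec (m : Matrix (Fin 2) (Fin 2) ℂ) :
    quatRep (quatProj m) + Complex.I • quatRep (quatProj ((-Complex.I) • m)) = m := by
  ext i j; fin_cases i <;> fin_cases j <;> simp [Complex.ext_iff, quatProj, quatRep] <;>
    constructor <;> ring

lemma quatRep_real (t : ℝ) (q : ℍ[ℝ]) : quatRep (t • q) = (t : ℂ) • quatRep q := by
  ext i j; fin_cases i <;> fin_cases j <;> simp [Complex.ext_iff, quatRep]

lemma quatRep_star (q : ℍ[ℝ]) :
    !![0, 1; -1, 0] * (quatRep q)ᵀ = quatRep (star q) * !![0, 1; -1, 0] := by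
  ext i j; fin_cases i <;> fin_cases j <;>
    simp [Complex.ext_iff, quatRep, Matrix.mul_apply, Fin.sum_univ_two]

variable {n : ℕ}

/-- The induced complex representation of quaternionic matrices. -/
noncomputable def matRep :
    Matrix (Fin n) (Fin n) ℍ[ℝ] →+* Matrix (Fin n × Fin 2) (Fin n × Fin 2) ℂ :=
  (Matrix.compRingEquiv (Fin n) (Fin 2) ℂ).toRingHom.comp quatRep.mapMatrix

lemma matRep_apply (A : Matrix (Fin n) (Fin n) ℍ[ℝ]) (i j a b) :
    matRep A (i, a) (j, b) = quatRep (A i j) a b := rfl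

lemma matRep_dec (M : Matrix (Fin n × Fin 2) (Fin n × Fin 2) ℂ) :
    ∃ P Q, M = matRep P + Complex.I • matRep Q := by
  refine ⟨fun i j => quatProj (fun a b => M (i, a) (j, b)),
    fun i j => quatProj ((-Complex.I) • (fun a b => M (i, a) (j, b))), ?_⟩
  ext ⟨i, a⟩ ⟨j, b⟩
  have := congrFun (congrFun (quatRep_dec (fun a b => M (i, a) (j, b))) a) b
  exact this.symm

lemma matRep_inj {P Q P' Q' : Matrix (Fin n) (Fin n) ℍ[ℝ]}
    (h : matRep P + Complex.I • matRep Q = matRep P' + Complex.I • matRep Q') :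
    P = P' ∧ Q = Q' := by
  have key : ∀ i j, quatRep (P i j) + Complex.I • quatRep (Q i j)
      = quatRep (P' i j) + Complex.I • quatRep (Q' i j) := by
    intro i j
    ext a b
    exact congrFun (congrFun h (i, a)) (j, b)
  constructor
  · ext1 i j
    rw [← quatProj_rep (P i j) (Q i j), key, quatProj_rep]
  · ext1 i j
    rw [← quatProj_rep' (P i j) (Q i j), key, quatProj_rep']

lemma matRep_real (t : ℝ) (A : Matrix (Fin n) (Fin n) ℍ[ℝ]) :
    matRep (t • A) = (t : ℂ) • matRep A := by
  ext ⟨i, a⟩ ⟨j, b⟩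
  exact congrFun (congrFun (quatRep_real t (A i j)) a) b

lemma matRep_star (A : Matrix (Fin n) (Fin n) ℍ[ℝ]) :
    ∃ J : Matrix (Fin n × Fin 2) (Fin n × Fin 2) ℂ, J.det ≠ 0 ∧
      J * (matRep A)ᵀ = matRep Aᴴ * J := by
  let Ψ := Matrix.compRingEquiv (Fin n) (Fin 2) ℂ
  let J2 : Matrix (Fin 2) (Fin 2) ℂ := !![0, 1; -1, 0]
  have hJ2 : J2 * J2 = -1 := by
    ext i j; fin_cases i <;> fin_cases j <;> simp [J2]
  refine ⟨Ψ (Matrix.diagonal fun _ => J2), ?_, ?_⟩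
  · have h : Ψ (Matrix.diagonal fun _ => J2) * Ψ (Matrix.diagonal fun _ => -J2) = 1 := by
      rw [← map_mul, Matrix.diagonal_mul_diagonal]
      simp [hJ2]
    exact (Matrix.isUnit_det_of_right_inverse h).ne_zero
  · have h1 : (matRep A)ᵀ = Ψ (Matrix.of fun i j => (quatRep (A j i))ᵀ) := rfl
    have h2 : matRep Aᴴ = Ψ (Matrix.of fun i j => quatRep (star (A j i))) := rfl
    rw [h1, h2, ← map_mul, ← map_mul]
    congr 1
    ext1 i j
    rw [Matrix.diagonal_mul, Matrix.mul_diagonal]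
    exact quatRep_star (A j i)

lemma matRep_isUnit {Y : Matrix (Fin n) (Fin n) ℍ[ℝ]} (h : (matRep Y).det ≠ 0) : IsUnit Y := by
  obtain ⟨P, Q, hPQ⟩ := matRep_dec (matRep Y)⁻¹
  have hu : IsUnit (matRep Y).det := isUnit_iff_ne_zero.2 h
  have h1 := Matrix.mul_nonsing_inv _ hu
  have h2 := Matrix.nonsing_inv_mul _ hu
  rw [hPQ] at h1 h2
  have e1 : Y * P = 1 := by
    refine (matRep_inj (Q := Y * Q) (Q' := 0) ?_).1
    simpa [mul_add] using h1
  have e2 : P * Y = 1 := by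
    refine (matRep_inj (Q := Q * Y) (Q' := 0) ?_).1
    simpa [add_mul] using h2
  exact ⟨⟨Y, P, e1, e2⟩, rfl⟩

lemma exists_real_det {m : Type*} [Fintype m] [DecidableEq m] (M N : Matrix m m ℂ)
    (h : (M + Complex.I • N).det ≠ 0) : ∃ t : ℝ, (M + (t : ℂ) • N).det ≠ 0 := by
  by_contra! hc
  let p : Polynomial ℂ := (M.map Polynomial.C + (Polynomial.X : Polynomial ℂ) • N.map Polynomial.C).det
  have hp : ∀ z, p.eval z = (M + z • N).det := by
    intro z
    rw [← Polynomial.coe_evalRingHom, RingHom.map_det]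
    congr 1
    ext i j
    simp
    ring
  have : p = 0 := by
    apply Polynomial.eq_zero_of_infinite_isRoot
    refine (Set.infinite_range_of_injective Complex.ofReal_injective).mono ?_
    rintro _ ⟨t, rfl⟩
    simp only [Set.mem_ofPred_eq, Polynomial.IsRoot, hp]
    exact hc t
  apply h
  rw [← hp, this, Polynomial.eval_zero]

end Q


/-- Every invertible quaternionic matrix is conjugate in `GL_n(ℍ)` to its conjugate
transpose. -/
theorem conj_to_conjTranspose {n : ℕ} (x : (Matrix (Fin n) (Fin n) ℍ[ℝ])ˣ) :
    ∃ y : (Matrix (Fin n) (Fin n) ℍ[ℝ])ˣ,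
      Units.val (y * x * y⁻¹) = (Units.val x)ᴴ := by
  obtain ⟨A, A', hA, hA'⟩ := x
  obtain ⟨S, hS, hSA⟩ := aux_transpose (matRep A)
  obtain ⟨J, hJ, hJA⟩ := matRep_star A
  obtain ⟨P, Q, hPQ⟩ := matRep_dec (J * S)
  have hcomm : (J * S) * matRep A = matRep Aᴴ * (J * S) := by
    rw [mul_assoc, hSA, ← mul_assoc, hJA, mul_assoc]
  have hdet : (J * S).det ≠ 0 := by
    rw [Matrix.det_mul]
    exact mul_ne_zero hJ hS
  rw [hPQ] at hcomm hdet
  obtain ⟨h1, h2⟩ : P * A = Aᴴ * P ∧ Q * A = Aᴴ * Q := by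
    apply matRep_inj
    simpa [mul_add, add_mul] using hcomm
  obtain ⟨t, ht⟩ := exists_real_det _ _ hdet
  rw [← matRep_real, ← map_add] at ht
  obtain ⟨y, hy⟩ := matRep_isUnit ht
  refine ⟨y, ?_⟩
  rw [Units.val_mul, Units.mul_inv_eq_iff_eq_mul, Units.val_mul, hy]
  simp [add_mul, mul_add, h1, h2]
end

section
/- Let ω be the standard symplectic form on ℝ^{2n} and let Sp_{2n}(ℝ) be its isometry group. Then for every x ∈ Sp_{2n}(ℝ), there exists g ∈ GL_{2n}(ℝ) such that ω(gu, gv) = ω(v, u) for all u, v ∈ ℝ^{2n}, and g·x·g⁻¹ = x⁻¹. -/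
/-- The standard symplectic form on `ℝ^{2n} = (Fin n → ℝ) × (Fin n → ℝ)`. -/
noncomputable def stdSymplectic (n : ℕ) (u v : (Fin n → ℝ) × (Fin n → ℝ)) : ℝ :=
  ∑ i : Fin n, (u.1 i * v.2 i - u.2 i * v.1 i)

open Polynomial

namespace MVW

variable {V : Type} [AddCommGroup V] [Module ℝ V]

/-- Symplectic data: alternating nondegenerate form, isometry with inverse. -/
structure SD (ω : V →ₗ[ℝ] V →ₗ[ℝ] ℝ) (x xi : Module.End ℝ V) : Prop where
  alt : ∀ u, ω u u = 0
  nd : ∀ u, (∀ v, ω u v = 0) → u = 0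
  mul1 : x * xi = 1
  mul2 : xi * x = 1
  iso : ∀ u v, ω (x u) (x v) = ω u v

variable {ω : V →ₗ[ℝ] V →ₗ[ℝ] ℝ} {x xi : Module.End ℝ V}

theorem SD.skew (h : SD ω x xi) (u v : V) : ω u v = - ω v u := by
  have := h.alt (u + v)
  simp only [map_add, LinearMap.add_apply, h.alt] at this
  linarith

theorem SD.x_xi (h : SD ω x xi) (u : V) : x (xi u) = u := by
  have := congrArg (fun e : Module.End ℝ V => e u) h.mul1
  simpa using this

theorem SD.xi_x (h : SD ω x xi) (u : V) : xi (x u) = u := by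
  have := congrArg (fun e : Module.End ℝ V => e u) h.mul2
  simpa using this

theorem SD.symm (h : SD ω x xi) : SD ω xi x where
  alt := h.alt
  nd := h.nd
  mul1 := h.mul2
  mul2 := h.mul1
  iso u v := by rw [← h.iso, h.x_xi, h.x_xi]

theorem SD.adj1 (h : SD ω x xi) (u v : V) : ω (x u) v = ω u (xi v) := by
  rw [← h.iso u, h.x_xi]

theorem SD.adj (h : SD ω x xi) (f : ℝ[X]) (u v : V) :
    ω (aeval x f u) v = ω u (aeval xi f v) := by
  induction f using Polynomial.induction_on generalizing u v with
  | C a => simp [Module.algebraMap_end_apply]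
  | add p q hp hq => simp [hp, hq]
  | monomial n a hh =>
    have e1 : (C a * X ^ (n+1) : ℝ[X]) = (C a * X ^ n) * X := by ring
    have e2 : (C a * X ^ (n+1) : ℝ[X]) = X * (C a * X ^ n) := by ring
    have l : aeval x (C a * X ^ (n+1) : ℝ[X]) u = aeval x (C a * X ^ n) (x u) := by
      rw [e1, map_mul _ (C a * X ^ n), Module.End.mul_apply, aeval_X]
    have l' : aeval xi (C a * X ^ (n+1) : ℝ[X]) v = xi (aeval xi (C a * X ^ n) v) := by
      rw [e2, map_mul _ X, Module.End.mul_apply, aeval_X]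
    rw [l, l', hh, h.adj1]

theorem SD.nd' (h : SD ω x xi) (u : V) (hu : ∀ v, ω v u = 0) : u = 0 :=
  h.nd u fun v => by rw [h.skew, hu, neg_zero]

theorem SD.rep [FiniteDimensional ℝ V] (h : SD ω x xi) (φ : V →ₗ[ℝ] ℝ) :
    ∃ w, ∀ u, ω w u = φ u := by
  have hinj : Function.Injective ω := by
    rw [injective_iff_map_eq_zero]
    intro a ha
    exact h.nd a fun v => by rw [ha]; rfl
  have hs := (LinearMap.injective_iff_surjective_of_finrank_eq_finrank
    (f := (ω : V →ₗ[ℝ] Module.Dual ℝ V)) (Subspace.dual_finrank_eq).symm).1 hinj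
  obtain ⟨w, hw⟩ := hs φ
  exact ⟨w, fun u => by rw [hw]⟩

theorem SD.exP [FiniteDimensional ℝ V] (h : SD ω x xi) : ∃ P : ℝ[X], aeval x P = xi := by
  let A := (aeval x : ℝ[X] →ₐ[ℝ] Module.End ℝ V).range
  let xA : A := ⟨x, X, by simp⟩
  have hinj : Function.Injective (LinearMap.mulLeft ℝ xA) := by
    rw [injective_iff_map_eq_zero]
    intro a ha
    have h1 : x * (a : Module.End ℝ V) = 0 := congrArg Subtype.val ha
    apply Subtype.ext
    calc (a : Module.End ℝ V) = xi * (x * a) := by rw [← mul_assoc, h.mul2, one_mul]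
      _ = 0 := by rw [h1, mul_zero]
  obtain ⟨⟨a, P, hP⟩, ha⟩ := (LinearMap.injective_iff_surjective.1 hinj) 1
  have h1 : x * a = 1 := congrArg Subtype.val ha
  refine ⟨P, ?_⟩
  calc aeval x P = a := hP
    _ = xi * (x * a) := by rw [← mul_assoc, h.mul2, one_mul]
    _ = xi := by rw [h1, mul_one]

theorem aeval_xi_eq {P : ℝ[X]} (hP : aeval x P = xi) (f : ℝ[X]) :
    aeval xi f = aeval x (f.comp P) := by
  rw [aeval_comp, hP]

theorem SD.aeval_xi_comp (h : SD ω x xi) {P : ℝ[X]} (hP : aeval x P = xi) (f : ℝ[X]) :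
    aeval xi (f.comp P) = aeval x f := by
  ext u
  rw [← sub_eq_zero]
  apply h.nd'
  intro v
  rw [map_sub, ← h.adj, ← aeval_xi_eq hP, ← h.symm.adj, sub_self]

/-- Conclusion. -/
def Good (ω : V →ₗ[ℝ] V →ₗ[ℝ] ℝ) (x : Module.End ℝ V) : Prop :=
  ∃ g : Module.End ℝ V, (∀ u v, ω (g u) (g v) = - ω u v) ∧ ∀ u, x (g (x u)) = g u

theorem SD.construct [FiniteDimensional ℝ V] (h : SD ω x xi) (v w : V)
    (H : ∀ f : ℝ[X], ω (aeval x f v) w = ω (aeval xi f v) w)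
    (hs : ∀ u, ∃ f k : ℝ[X], u = aeval x f v + aeval x k w) : Good ω x := by
  obtain ⟨P, hP⟩ := h.exP
  let Φ : (ℝ[X] × ℝ[X]) →ₗ[ℝ] V :=
    ((LinearMap.applyₗ v).comp (aeval x).toLinearMap).coprod
      ((LinearMap.applyₗ w).comp (aeval x).toLinearMap)
  let Ψ : (ℝ[X] × ℝ[X]) →ₗ[ℝ] V :=
    ((LinearMap.applyₗ v).comp (aeval xi).toLinearMap).coprod
      (-(LinearMap.applyₗ w).comp (aeval xi).toLinearMap)
  have hΦ : ∀ f k, Φ (f, k) = aeval x f v + aeval x k w := fun f k => by simp [Φ]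
  have hΨ : ∀ f k, Ψ (f, k) = aeval xi f v - aeval xi k w := fun f k => by
    simp [Ψ, sub_eq_add_neg]
  have key1 : ∀ p p', ω (Ψ p) (Φ p') = - ω (Φ p) (Ψ p') := by
    rintro ⟨f, k⟩ ⟨a, c⟩
    rw [hΦ, hΨ, hΦ, hΨ]
    simp only [map_add, map_sub, LinearMap.add_apply, LinearMap.sub_apply]
    have e1 : ω (aeval xi f v) (aeval x a v) = - ω (aeval x f v) (aeval xi a v) := by
      rw [← h.symm.adj, ← Module.End.mul_apply, ← map_mul, mul_comm, map_mul,
        Module.End.mul_apply, h.symm.adj, h.skew]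
    have e2 : ω (aeval xi k w) (aeval x c w) = - ω (aeval x k w) (aeval xi c w) := by
      rw [← h.symm.adj, ← Module.End.mul_apply, ← map_mul, mul_comm, map_mul,
        Module.End.mul_apply, h.symm.adj, h.skew]
    have e3 : ω (aeval xi f v) (aeval x c w) = ω (aeval x f v) (aeval xi c w) := by
      rw [← h.symm.adj, ← h.adj, ← Module.End.mul_apply, ← Module.End.mul_apply, ← map_mul,
        ← map_mul, H]
    have e4 : ω (aeval xi k w) (aeval x a v) = ω (aeval x k w) (aeval xi a v) := by
      rw [h.skew, h.skew (aeval x k w)]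
      rw [← h.adj, ← h.symm.adj, ← Module.End.mul_apply, ← Module.End.mul_apply, ← map_mul,
        ← map_mul, H]
    rw [e1, e2, e3, e4]; ring
  have key2 : ∀ p p', ω (Ψ p) (Ψ p') = - ω (Φ p) (Φ p') := by
    have e1 : ∀ (f a : ℝ[X]) v, ω (aeval xi f v) (aeval xi a v)
        = - ω (aeval x f v) (aeval x a v) := by
      intro f a v
      rw [h.symm.adj, ← h.skew, h.adj, aeval_xi_eq hP, ← Module.End.mul_apply,
        ← map_mul, mul_comm, map_mul, Module.End.mul_apply]
    have e3 : ∀ (f c : ℝ[X]), ω (aeval xi f v) (aeval xi c w) = ω (aeval x f v) (aeval x c w) := by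
      intro f c
      rw [← h.adj, ← h.symm.adj, aeval_xi_eq hP, ← Module.End.mul_apply, ← map_mul, H,
        map_mul, Module.End.mul_apply, h.aeval_xi_comp hP]
    rintro ⟨f, k⟩ ⟨a, c⟩
    rw [hΦ, hΨ, hΦ, hΨ]
    simp only [map_add, map_sub, LinearMap.add_apply, LinearMap.sub_apply]
    have e4 := e3 a k
    rw [h.skew, h.skew (aeval x a v)] at e4
    rw [e1, e1, e3]; linarith
  have hsurj : ∀ u, ∃ p, Φ p = u := fun u => by
    obtain ⟨f, k, e⟩ := hs u
    exact ⟨(f, k), by rw [hΦ, e]⟩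
  have hker : ∀ p, Φ p = 0 → Ψ p = 0 := by
    intro p hp
    apply h.nd
    intro u
    obtain ⟨p', rfl⟩ := hsurj u
    rw [key1, hp]; simp
  obtain ⟨σ, hσ⟩ := Φ.exists_rightInverse_of_surjective (LinearMap.range_eq_top.2 hsurj)
  have hg : ∀ p, Ψ (σ (Φ p)) = Ψ p := by
    intro p
    rw [← sub_eq_zero, ← map_sub]
    apply hker
    rw [map_sub, sub_eq_zero]
    exact congrArg (fun e : V →ₗ[ℝ] V => e (Φ p)) hσ
  refine ⟨Ψ.comp σ, ?_, ?_⟩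
  · intro u u'
    obtain ⟨p, rfl⟩ := hsurj u
    obtain ⟨p', rfl⟩ := hsurj u'
    simp only [LinearMap.comp_apply, hg, key2]
  · intro u
    obtain ⟨⟨f, k⟩, rfl⟩ := hsurj u
    have e : x (Φ (f, k)) = Φ (X * f, X * k) := by simp [hΦ]
    have e' : xi (Ψ (f, k)) = Ψ (X * f, X * k) := by simp [hΨ]
    rw [e]
    simp only [LinearMap.comp_apply, hg]
    rw [← e', h.x_xi]

/-- Indecomposability. -/
def Indec (ω : V →ₗ[ℝ] V →ₗ[ℝ] ℝ) (x xi : Module.End ℝ V) : Prop :=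
  ∀ W : Submodule ℝ V, (∀ u ∈ W, x u ∈ W) → (∀ u ∈ W, xi u ∈ W) →
    (∀ u ∈ W, (∀ v ∈ W, ω u v = 0) → u = 0) → W = ⊥ ∨ W = ⊤

theorem SD.restr (h : SD ω x xi) (W : Submodule ℝ V) (h1 : ∀ u ∈ W, x u ∈ W)
    (h2 : ∀ u ∈ W, xi u ∈ W) (h3 : ∀ u ∈ W, (∀ v ∈ W, ω u v = 0) → u = 0) :
    SD (ω.domRestrict₁₂ W W) (x.restrict h1) (xi.restrict h2) where
  alt u := h.alt u
  nd u hu := Subtype.ext (h3 u u.2 fun v hv => hu ⟨v, hv⟩)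
  mul1 := by ext u; exact h.x_xi u
  mul2 := by ext u; exact h.xi_x u
  iso u v := h.iso u v

theorem SD.split [FiniteDimensional ℝ V] (h : SD ω x xi)
    (IH : ∀ (W : Type) [AddCommGroup W] [Module ℝ W] [FiniteDimensional ℝ W]
      (ω' : W →ₗ[ℝ] W →ₗ[ℝ] ℝ) (x' xi' : Module.End ℝ W), SD ω' x' xi' →
      Module.finrank ℝ W < Module.finrank ℝ V → Good ω' x')
    (W : Submodule ℝ V) (h1 : ∀ u ∈ W, x u ∈ W)
    (h2 : ∀ u ∈ W, xi u ∈ W) (h3 : ∀ u ∈ W, (∀ v ∈ W, ω u v = 0) → u = 0)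
    (hb : W ≠ ⊥) (ht : W ≠ ⊤) : Good ω x := by
  have hW := h.restr W h1 h2 h3
  let U : Submodule ℝ V :=
    { carrier := {u | ∀ w ∈ W, ω u w = 0}
      add_mem' := fun {a b} ha hb w hw => by simp [ha w hw, hb w hw]
      zero_mem' := fun w _ => by simp
      smul_mem' := fun c a ha w hw => by simp [ha w hw] }
  have hU : ∀ u ∈ U, ∀ w ∈ W, ω u w = 0 := fun u hu => hu
  have hU' : ∀ u ∈ U, ∀ w ∈ W, ω w u = 0 := fun u hu w hw => by rw [h.skew, hu w hw, neg_zero]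
  have hcod : ∀ u, ∃ w ∈ W, u - w ∈ U := by
    intro u
    obtain ⟨w, hw⟩ := hW.rep ((ω u).comp W.subtype)
    refine ⟨w, w.2, fun w' hw' => ?_⟩
    have := hw ⟨w', hw'⟩
    change ω w w' = ω u w' at this
    simp [this]
  have hc : IsCompl W U := by
    constructor
    · rw [Submodule.disjoint_def]
      intro u hu hu'
      exact h3 u hu hu'
    · rw [codisjoint_iff, eq_top_iff]
      intro u _
      obtain ⟨w, hw, hu⟩ := hcod u
      exact Submodule.mem_sup.2 ⟨w, hw, u - w, hu, by abel⟩
  have k1 : ∀ u ∈ U, x u ∈ U := fun u hu w hw => by rw [h.adj1, hu _ (h2 w hw)]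
  have k2 : ∀ u ∈ U, xi u ∈ U := fun u hu w hw => by rw [h.symm.adj1, hu _ (h1 w hw)]
  have k3 : ∀ u ∈ U, (∀ v ∈ U, ω u v = 0) → u = 0 := by
    intro u hu hh
    apply h.nd
    intro v
    obtain ⟨w, hw, hv⟩ := hcod v
    have e : v = w + (v - w) := by abel
    rw [e, map_add, hU u hu w hw, hh _ hv, add_zero]
  have hUt : U ≠ ⊤ := by
    intro e
    apply hb
    have := hc.disjoint
    rw [e, disjoint_top] at this
    exact this
  obtain ⟨g1, a1, b1⟩ := IH W _ _ _ hW (Submodule.finrank_lt ht)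
  obtain ⟨g2, a2, b2⟩ := IH U _ _ _ (h.restr U k1 k2 k3) (Submodule.finrank_lt hUt)
  let g := LinearMap.ofIsCompl hc (W.subtype.comp g1) (U.subtype.comp g2)
  have hgW : ∀ w : W, g w = g1 w := fun w => by simp [g]
  have hgU : ∀ w : U, g w = g2 w := fun w => by simp [g]
  have hdec : ∀ u, ∃ (w : W) (w' : U), u = (w : V) + (w' : V) := fun u => by
    obtain ⟨w, hw, hv⟩ := hcod u
    exact ⟨⟨w, hw⟩, ⟨u - w, hv⟩, by simp⟩
  refine ⟨g, ?_, ?_⟩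
  · intro u v
    obtain ⟨u1, u2, rfl⟩ := hdec u
    obtain ⟨v1, v2, rfl⟩ := hdec v
    have c1 : ω (g1 u1) (g1 v1) = - ω u1 v1 := a1 u1 v1
    have c2 : ω (g2 u2) (g2 v2) = - ω u2 v2 := a2 u2 v2
    simp only [map_add, LinearMap.add_apply, hgW, hgU, c1, c2]
    rw [hU _ u2.2 _ v1.2, hU _ (g2 u2).2 _ (g1 v1).2, hU' _ v2.2 _ u1.2,
      hU' _ (g2 v2).2 _ (g1 u1).2]
    ring
  · intro u
    obtain ⟨u1, u2, rfl⟩ := hdec u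
    have c1 : x (g1 (x.restrict h1 u1)) = g1 u1 := congrArg Subtype.val (b1 u1)
    have c2 : x (g2 (x.restrict k1 u2)) = g2 u2 := congrArg Subtype.val (b2 u2)
    have d1 : g (x u1) = g1 (x.restrict h1 u1) := hgW (x.restrict h1 u1)
    have d2 : g (x u2) = g2 (x.restrict k1 u2) := hgU (x.restrict k1 u2)
    rw [map_add, map_add, map_add, d1, d2, c1, c2, map_add, hgW, hgU]

theorem SD.fitting [FiniteDimensional ℝ V] (h : SD ω x xi) (hI : Indec ω x xi) (f : ℝ[X])
    (hf : aeval xi f = aeval x f) :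
    Function.Injective (aeval x f : Module.End ℝ V) ∨ IsNilpotent (aeval x f : Module.End ℝ V) := by
  set s : Module.End ℝ V := aeval x f with hs
  obtain ⟨N, hN, hN1⟩ := ((LinearMap.eventually_isCompl_ker_pow_range_pow s).and
    (Filter.eventually_ge_atTop 1)).exists
  have hp : s ^ N = aeval x (f ^ N) := by rw [map_pow]
  have hp' : s ^ N = aeval xi (f ^ N) := by rw [map_pow, hf]
  have hcx : ∀ u, x ((s ^ N) u) = (s ^ N) (x u) := by
    intro u
    have : aeval x (X * f ^ N) = aeval x (f ^ N * X) := by rw [mul_comm]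
    rw [map_mul, map_mul, ← hp, aeval_X] at this
    exact congrArg (fun e : Module.End ℝ V => e u) this
  have hcxi : ∀ u, xi ((s ^ N) u) = (s ^ N) (xi u) := by
    intro u
    have : aeval xi (X * f ^ N) = aeval xi (f ^ N * X) := by rw [mul_comm]
    rw [map_mul, map_mul, ← hp', aeval_X] at this
    exact congrArg (fun e : Module.End ℝ V => e u) this
  have t1 : ∀ u ∈ (s ^ N).range, x u ∈ (s ^ N).range := by
    rintro _ ⟨u, rfl⟩
    exact ⟨x u, (hcx u).symm⟩
  have t2 : ∀ u ∈ (s ^ N).range, xi u ∈ (s ^ N).range := by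
    rintro _ ⟨u, rfl⟩
    exact ⟨xi u, (hcxi u).symm⟩
  have t3 : ∀ u ∈ (s ^ N).range, (∀ v ∈ (s ^ N).range, ω u v = 0) → u = 0 := by
    intro u hu hh
    have := hN.disjoint
    rw [Submodule.disjoint_def] at this
    refine this u ?_ hu
    rw [LinearMap.mem_ker]
    apply h.nd
    intro v
    rw [hp, h.adj, ← hp']
    exact hh _ ⟨v, rfl⟩
  rcases hI (s ^ N).range t1 t2 t3 with h1 | h1
  · right
    exact ⟨N, LinearMap.range_eq_bot.1 h1⟩
  · left
    have hinj : Function.Injective (s ^ N) :=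
      LinearMap.injective_iff_surjective.2 (LinearMap.range_eq_top.1 h1)
    obtain ⟨M, rfl⟩ : ∃ M, N = M + 1 := ⟨N - 1, by omega⟩
    intro a b hab
    apply hinj
    rw [pow_succ, Module.End.mul_apply, Module.End.mul_apply, hab]

theorem socle [Nontrivial V] (z : Module.End ℝ V) (q : ℝ[X]) (hq : Prime q)
    (hn : IsNilpotent (aeval z q : Module.End ℝ V)) :
    ∃ k, (aeval z (q ^ k) : Module.End ℝ V) ≠ 0 ∧ (aeval z (q ^ (k + 1)) : Module.End ℝ V) = 0 ∧
      ∀ f : ℝ[X], (aeval z f : Module.End ℝ V) ≠ 0 →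
        ∃ r : ℝ[X], (aeval z (r * f) : Module.End ℝ V) = aeval z (q ^ k) := by
  classical
  have hex : ∃ m, (aeval z (q ^ m) : Module.End ℝ V) = 0 := by
    obtain ⟨m, hm⟩ := hn
    exact ⟨m, by rw [map_pow, hm]⟩
  have h0 : Nat.find hex ≠ 0 := by
    intro e
    have := Nat.find_spec hex
    rw [e] at this
    simp at this
  obtain ⟨k, hk⟩ := Nat.exists_eq_succ_of_ne_zero h0
  have hk1 : (aeval z (q ^ (k + 1)) : Module.End ℝ V) = 0 := by
    have := Nat.find_spec hex
    rwa [hk] at this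
  refine ⟨k, Nat.find_min hex (by omega), hk1, ?_⟩
  intro f hf
  obtain ⟨i, hi, hass⟩ := (dvd_prime_pow hq (k + 1)).1
    (EuclideanDomain.gcd_dvd_right f (q ^ (k + 1)))
  have hik : i ≤ k := by
    by_contra hlt
    have : i = k + 1 := by omega
    subst this
    obtain ⟨t, ht⟩ := hass.symm.dvd.trans (EuclideanDomain.gcd_dvd_left f (q ^ (k + 1)))
    apply hf
    rw [ht, map_mul, hk1, zero_mul]
  obtain ⟨t, ht⟩ := hass.dvd.trans (pow_dvd_pow q hik)
  refine ⟨EuclideanDomain.gcdA f (q ^ (k + 1)) * t, ?_⟩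
  have e : q ^ k = EuclideanDomain.gcdA f (q ^ (k + 1)) * t * f +
      q ^ (k + 1) * (EuclideanDomain.gcdB f (q ^ (k + 1)) * t) := by
    conv_lhs => rw [ht, EuclideanDomain.gcd_eq_gcd_ab]
    ring
  have e' := congrArg (fun p : ℝ[X] => (aeval z p : Module.End ℝ V)) e
  simp only [map_add] at e'
  rw [e', map_mul (aeval z) (q ^ (k + 1)), hk1, zero_mul, add_zero]

theorem SD.exists_diag (h : SD ω x xi) (T Ts : Module.End ℝ V)
    (hT : ∀ u v, ω (T u) v = ω u (Ts v)) (hs : Ts = -T) (h0 : T ≠ 0) : ∃ v, ω (T v) v ≠ 0 := by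
  by_contra! hc
  apply h0
  ext u
  apply h.nd
  intro v
  have e := hc (u + v)
  have e2 : ω (T v) u = ω (T u) v := by
    rw [hT, hs, h.skew]; simp
  simp only [map_add, LinearMap.add_apply, hc, e2] at e
  linarith

/-- Case 1: `x - x⁻¹` is injective. -/
theorem SD.case1 [FiniteDimensional ℝ V] [Nontrivial V] (h : SD ω x xi) (hI : Indec ω x xi)
    (hd : Function.Injective (x - xi : Module.End ℝ V)) : Good ω x := by
  obtain ⟨P, hP⟩ := h.exP
  have hP' : aeval xi P = x := by
    have := h.aeval_xi_comp hP X
    simpa using this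
  set y : Module.End ℝ V := x + xi with hy
  set d : Module.End ℝ V := x - xi with hd'
  have hG : ∀ r : ℝ[X], aeval y r = aeval x (r.comp (X + P)) := fun r => by
    rw [aeval_comp]; simp [hP, hy]
  have hG' : ∀ r : ℝ[X], aeval y r = aeval xi (r.comp (X + P)) := fun r => by
    rw [aeval_comp]; simp [hP', hy, add_comm]
  have hdF : d = aeval x (X - P) := by simp [hP, hd']
  have sa : ∀ (r : ℝ[X]) u v, ω (aeval y r u) v = ω u (aeval y r v) := fun r u v => by
    rw [hG, h.adj, ← hG', ← hG]
  have da : ∀ u v, ω (d u) v = - ω u (d v) := fun u v => by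
    simp only [hd', LinearMap.sub_apply, map_sub, h.adj1, h.symm.adj1]; ring
  have cGd : ∀ r : ℝ[X], aeval y r * d = d * aeval y r := fun r => by
    rw [hG, hdF, ← map_mul, mul_comm, map_mul]
  have cGd' : ∀ (r : ℝ[X]) u, aeval y r (d u) = d (aeval y r u) := fun r u => by
    rw [← Module.End.mul_apply, cGd, Module.End.mul_apply]
  have hdd : d * d = aeval y (X ^ 2 - 4 : ℝ[X]) := by
    have e4 : (aeval y (4 : ℝ[X]) : Module.End ℝ V) = 4 := by
      rw [map_ofNat]
    rw [map_sub, map_pow, aeval_X, e4, hy, hd', pow_two]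
    have := h.mul1
    have := h.mul2
    simp only [mul_add, add_mul, mul_sub, sub_mul, h.mul1, h.mul2]
    have : (4 : Module.End ℝ V) = 1 + 1 + 1 + 1 := by norm_num
    rw [this]; abel
  have hintg : IsIntegral ℝ y := Algebra.IsIntegral.isIntegral y
  obtain ⟨q, hq, t, hqt⟩ := WfDvdMonoid.exists_irreducible_factor (minpoly.not_isUnit ℝ y)
    (minpoly.ne_zero hintg)
  have hqn : IsNilpotent (aeval y q : Module.End ℝ V) := by
    rcases h.fitting hI (q.comp (X + P)) (by rw [← hG, ← hG']) with h1 | h1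
    · exfalso
      rw [← hG] at h1
      have h0 : (aeval y q : Module.End ℝ V) * aeval y t = 0 := by
        rw [← map_mul, ← hqt, minpoly.aeval]
      have ht : (aeval y t : Module.End ℝ V) = 0 := by
        ext u
        apply h1
        rw [← Module.End.mul_apply, h0]; simp
      have hdv := minpoly.dvd ℝ y ht
      obtain ⟨m, hm⟩ := hdv
      have hne := minpoly.ne_zero hintg
      have : minpoly ℝ y * (q * m) = minpoly ℝ y * 1 := by
        calc minpoly ℝ y * (q * m) = q * (minpoly ℝ y * m) := by ring
          _ = q * t := by rw [← hm]
          _ = minpoly ℝ y * 1 := by rw [← hqt, mul_one]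
      exact hq.not_isUnit (IsUnit.of_mul_eq_one m (mul_left_cancel₀ hne this))
    · rwa [← hG] at h1
  obtain ⟨k, hT0, -, hr⟩ := socle y q hq.prime hqn
  set T : Module.End ℝ V := aeval y (q ^ k) with hT
  have hTd : T * d ≠ 0 := by
    intro e
    apply hT0
    have e2 : d * T = 0 := by rw [hT, ← cGd, ← hT, e]
    ext u
    apply hd
    rw [← Module.End.mul_apply, e2]; simp
  obtain ⟨v, hv⟩ := h.exists_diag (T * d) (-(T * d)) (fun u w => by
    rw [Module.End.mul_apply, hT, sa, da, ← cGd']; simp) rfl hTd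
  rw [Module.End.mul_apply] at hv
  have z1 : ∀ a : ℝ[X], ω (aeval y a v) v = 0 := fun a => by
    have e1 := sa a v v
    rw [h.skew v] at e1
    linarith
  let Φ : (ℝ[X] × ℝ[X]) →ₗ[ℝ] V :=
    ((LinearMap.applyₗ v).comp (aeval y).toLinearMap).coprod
      ((LinearMap.applyₗ (d v)).comp (aeval y).toLinearMap)
  have hΦ : ∀ f k, Φ (f, k) = aeval y f v + aeval y k (d v) := fun f k => by simp [Φ]
  have yΦ : ∀ f k, y (Φ (f, k)) = Φ (X * f, X * k) := fun f k => by simp [hΦ]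
  have dΦ : ∀ f k, d (Φ (f, k)) = Φ ((X ^ 2 - 4) * k, f) := fun f k => by
    rw [hΦ, hΦ, map_add, ← cGd', ← cGd', mul_comm, map_mul, Module.End.mul_apply, ← hdd,
      Module.End.mul_apply, add_comm]
  have hx2 : ∀ u, x u = (1/2 : ℝ) • (y u + d u) := fun u => by
    simp only [hy, hd', LinearMap.add_apply, LinearMap.sub_apply]; module
  have hxi2 : ∀ u, xi u = (1/2 : ℝ) • (y u - d u) := fun u => by
    simp only [hy, hd', LinearMap.add_apply, LinearMap.sub_apply]; module
  have t1 : ∀ u ∈ Φ.range, x u ∈ Φ.range := by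
    rintro _ ⟨⟨f, k⟩, rfl⟩
    rw [hx2, yΦ, dΦ]
    exact Submodule.smul_mem _ _ (Submodule.add_mem _ ⟨_, rfl⟩ ⟨_, rfl⟩)
  have t2 : ∀ u ∈ Φ.range, xi u ∈ Φ.range := by
    rintro _ ⟨⟨f, k⟩, rfl⟩
    rw [hxi2, yΦ, dΦ]
    exact Submodule.smul_mem _ _ (Submodule.sub_mem _ ⟨_, rfl⟩ ⟨_, rfl⟩)
  have t3 : ∀ u ∈ Φ.range, (∀ v ∈ Φ.range, ω u v = 0) → u = 0 := by
    rintro _ ⟨⟨a, c⟩, rfl⟩ hh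
    have hc : (aeval y c : Module.End ℝ V) = 0 := by
      by_contra hne
      obtain ⟨r, hr⟩ := hr c hne
      apply hv
      have e := hh (Φ (r, 0)) ⟨_, rfl⟩
      rw [hΦ, hΦ] at e
      simp only [map_zero, LinearMap.zero_apply, add_zero, map_add, LinearMap.add_apply] at e
      rw [← sa, ← sa, ← Module.End.mul_apply, ← Module.End.mul_apply, ← map_mul, ← map_mul, z1,
        zero_add, hr] at e
      exact e
    have ha : (aeval y a : Module.End ℝ V) = 0 := by
      by_contra hne
      obtain ⟨r, hr⟩ := hr a hne
      apply hv
      have e := hh (Φ (0, r)) ⟨_, rfl⟩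
      rw [hΦ, hΦ, hc] at e
      simp only [map_zero, LinearMap.zero_apply, add_zero, zero_add] at e
      rw [← sa, ← Module.End.mul_apply, ← map_mul, hr] at e
      rw [hT, cGd', da, ← hT, e, neg_zero]
    rw [hΦ, hc, ha]; simp
  rcases hI Φ.range t1 t2 t3 with hb | ht
  · exfalso
    have : v ∈ Φ.range := ⟨(1, 0), by simp [hΦ]⟩
    rw [hb, Submodule.mem_bot] at this
    apply hv
    rw [this]; simp
  · apply h.construct v 0
    · simp
    · intro u
      have : u ∈ Φ.range := by rw [ht]; trivial
      obtain ⟨⟨a, c⟩, rfl⟩ := this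
      refine ⟨a.comp (X + P) + c.comp (X + P) * (X - P), 0, ?_⟩
      rw [hΦ, map_add, map_mul, ← hG, ← hG, ← hdF]
      simp

/-- Case 2: `x - ε` is nilpotent. -/
theorem SD.case2 [FiniteDimensional ℝ V] [Nontrivial V] (h : SD ω x xi) (hI : Indec ω x xi)
    (ε : ℝ) (hε : ε * ε = 1) (hn : IsNilpotent (aeval x (X - C ε) : Module.End ℝ V)) :
    Good ω x := by
  obtain ⟨P, hP⟩ := h.exP
  obtain ⟨k, hT0, hT1, hr⟩ := socle x (X - C ε) (prime_X_sub_C ε) hn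
  set T : Module.End ℝ V := aeval x ((X - C ε) ^ k) with hT
  set n : Module.End ℝ V := aeval x (X - C ε) with hndef
  have hn' : n = x - ε • 1 := by
    rw [hndef, map_sub, aeval_X, aeval_C, Algebra.algebraMap_eq_smul_one]
  have hxT : x * T = ε • T := by
    have e : n * T = 0 := by
      rw [hndef, hT, ← map_mul, ← pow_succ', hT1]
    rw [hn', sub_mul, sub_eq_zero] at e
    simpa using e
  have hxiT : xi * T = ε • T := by
    calc xi * T = xi * ((ε * ε) • T) := by rw [hε, one_smul]
      _ = ε • (xi * (x * T)) := by rw [hxT, mul_smul, mul_smul_comm]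
      _ = ε • T := by rw [← mul_assoc, h.mul2, one_mul]
  have hxikT : ∀ j : ℕ, xi ^ j * T = ε ^ j • T := by
    intro j
    induction j with
    | zero => simp
    | succ j ih => rw [pow_succ, mul_assoc, hxiT, mul_smul_comm, ih, smul_smul, pow_succ']
  have hns : aeval xi (X - C ε) = (-ε) • (xi * n) := by
    rw [hn', map_sub, aeval_X, aeval_C, Algebra.algebraMap_eq_smul_one, mul_sub, h.mul2,
      mul_smul_comm, mul_one, smul_sub, smul_smul, neg_mul, hε]
    module
  have hcomm : Commute xi n := by
    rw [← hP, hndef, Commute, SemiconjBy, ← map_mul, mul_comm, map_mul]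
  have hTs : aeval xi ((X - C ε) ^ k) = ((-1 : ℝ) ^ k) • T := by
    rw [map_pow, hns, _root_.smul_pow, hcomm.mul_pow]
    have : n ^ k = T := by rw [hT, map_pow]
    rw [this, hxikT, smul_smul, ← mul_pow, neg_mul, hε]
  have hfaith : ∀ v, T v ≠ 0 → ∀ f : ℝ[X], aeval x f v = 0 → (aeval x f : Module.End ℝ V) = 0 := by
    intro v hv f hf
    by_contra hne
    obtain ⟨r, hr⟩ := hr f hne
    apply hv
    rw [← hr, map_mul, Module.End.mul_apply, hf, map_zero]
  have hTadj : ∀ u v, ω (T u) v = ω u (aeval xi ((X - C ε) ^ k) v) := fun u v => h.adj _ _ _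
  rcases Nat.even_or_odd k with hk | hk
  · -- `T` is self-adjoint
    rw [hk.neg_one_pow, one_smul] at hTs
    rw [hTs] at hTadj
    have hTalt : ∀ u, ω (T u) u = 0 := fun u => by
      have e1 := hTadj u u
      rw [h.skew u] at e1
      linarith
    obtain ⟨v, hv⟩ : ∃ v, T v ≠ 0 := by
      by_contra! hc
      exact hT0 (LinearMap.ext hc)
    let D : ℝ[X] →ₗ[ℝ] V := (LinearMap.applyₗ v).comp
      ((aeval x).toLinearMap - (aeval xi).toLinearMap)
    have hD : ∀ f, D f = aeval x f v - aeval xi f v := fun f => by simp [D]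
    have hnot : T v ∉ D.range := by
      rintro ⟨f, hf⟩
      rw [hD] at hf
      have e : (aeval x (f - f.comp P - (X - C ε) ^ k) : Module.End ℝ V) = 0 := by
        apply hfaith v hv
        rw [map_sub, map_sub, ← aeval_xi_eq hP, ← hT]
        simp only [LinearMap.sub_apply]
        rw [hf, sub_self]
      have e1 := e
      rw [map_sub, map_sub, ← aeval_xi_eq hP, ← hT] at e1
      have e2 : aeval xi (f - f.comp P - (X - C ε) ^ k) = 0 := by
        ext u
        apply h.nd'
        intro w
        rw [← h.adj, e]; simp
      rw [map_sub, map_sub, h.aeval_xi_comp hP, hTs] at e2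
      apply hT0
      have e3 : (2 : ℝ) • T = 0 := by
        have : (2 : ℝ) • T = -((aeval x f - aeval xi f - T) + (aeval xi f - aeval x f - T)) := by
          module
        rw [this, e1, e2]; simp
      simpa using e3
    obtain ⟨φ, hφ, hle⟩ := Submodule.exists_le_ker_of_notMem hnot
    obtain ⟨w, hw⟩ := h.rep φ
    have hvw : ω (T v) w ≠ 0 := by
      rw [h.skew, hw]; simpa using hφ
    have hwv : ω (T w) v ≠ 0 := by
      rw [hTadj, hw]; exact hφ
    have H : ∀ f : ℝ[X], ω (aeval x f v) w = ω (aeval xi f v) w := by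
      intro f
      have : φ (D f) = 0 := hle ⟨f, rfl⟩
      rw [hD, map_sub, ← hw, ← hw] at this
      rw [h.skew, h.skew (aeval xi f v)]
      linarith
    let Φ : (ℝ[X] × ℝ[X]) →ₗ[ℝ] V :=
      ((LinearMap.applyₗ v).comp (aeval x).toLinearMap).coprod
        ((LinearMap.applyₗ w).comp (aeval x).toLinearMap)
    have hΦ : ∀ f k, Φ (f, k) = aeval x f v + aeval x k w := fun f k => by simp [Φ]
    have mulΦ : ∀ p f k : ℝ[X], aeval x p (Φ (f, k)) = Φ (p * f, p * k) := fun p f k => by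
      simp [hΦ]
    have t0 : ∀ p : ℝ[X], ∀ u ∈ Φ.range, aeval x p u ∈ Φ.range := by
      rintro p _ ⟨⟨f, k⟩, rfl⟩
      exact ⟨_, (mulΦ p f k).symm⟩
    have t1 : ∀ u ∈ Φ.range, x u ∈ Φ.range := by simpa using t0 X
    have t2 : ∀ u ∈ Φ.range, xi u ∈ Φ.range := by simpa [hP] using t0 P
    have hsoc : ∀ f : ℝ[X], (aeval x ((X - C ε) * f) : Module.End ℝ V) = 0 →
        ∃ c : ℝ, (aeval x f : Module.End ℝ V) = c • T := by
      intro f hf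
      by_cases hne : (aeval x f : Module.End ℝ V) = 0
      · exact ⟨0, by rw [hne, zero_smul]⟩
      obtain ⟨r, hr⟩ := hr f hne
      obtain ⟨r', hr'⟩ := X_sub_C_dvd_sub_C_eval (a := ε) (p := r)
      have e : r * f = C (r.eval ε) * f + r' * ((X - C ε) * f) := by
        linear_combination f * hr'
      rw [e, map_add, map_mul (aeval x) r', hf, mul_zero, add_zero, map_mul, aeval_C,
        Algebra.algebraMap_eq_smul_one, smul_one_mul] at hr
      refine ⟨(r.eval ε)⁻¹, ?_⟩
      have hne' : r.eval ε ≠ 0 := by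
        intro e0
        rw [e0, zero_smul] at hr
        exact hT0 hr.symm
      rw [← hr, smul_smul, inv_mul_cancel₀ hne', one_smul]
    have t3 : ∀ u ∈ Φ.range, (∀ v ∈ Φ.range, ω u v = 0) → u = 0 := by
      rintro _ ⟨⟨a, c⟩, rfl⟩ hh
      have hh' : ∀ p : ℝ[X], ∀ z ∈ Φ.range, ω (Φ (p * a, p * c)) z = 0 := by
        intro p z hz
        rw [← mulΦ, h.adj, aeval_xi_eq hP]
        exact hh _ (t0 _ z hz)
      have main : ∀ j, j ≤ k + 1 →
          (aeval x ((X - C ε) ^ (k + 1 - j) * a) : Module.End ℝ V) = 0 ∧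
          (aeval x ((X - C ε) ^ (k + 1 - j) * c) : Module.End ℝ V) = 0 := by
        intro j
        induction j with
        | zero =>
          intro _
          rw [Nat.sub_zero, map_mul, map_mul, hT1]; simp
        | succ j ih =>
          intro hj
          obtain ⟨ia, ic⟩ := ih (by omega)
          have ej : k + 1 - j = (k + 1 - (j + 1)) + 1 := by omega
          rw [ej, pow_succ', mul_assoc] at ia ic
          obtain ⟨α, hα⟩ := hsoc _ ia
          obtain ⟨γ, hγ⟩ := hsoc _ ic
          have ew := hh' ((X - C ε) ^ (k + 1 - (j + 1))) w ⟨(0, 1), by simp [hΦ]⟩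
          have ev := hh' ((X - C ε) ^ (k + 1 - (j + 1))) v ⟨(1, 0), by simp [hΦ]⟩
          rw [hΦ, hα, hγ] at ew ev
          simp only [LinearMap.smul_apply, map_add, map_smul, LinearMap.add_apply, hTalt,
            smul_eq_mul, mul_zero, add_zero, zero_add, mul_eq_zero, hvw, hwv, or_false] at ew ev
          rw [hα, hγ, ew, ev]; simp
      obtain ⟨ma, mc⟩ := main (k + 1) le_rfl
      simp only [Nat.sub_self, pow_zero, one_mul] at ma mc
      rw [hΦ, ma, mc]; simp
    rcases hI Φ.range t1 t2 t3 with hb | ht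
    · exfalso
      have : v ∈ Φ.range := ⟨(1, 0), by simp [hΦ]⟩
      rw [hb, Submodule.mem_bot] at this
      apply hv
      rw [this]; simp
    · apply h.construct v w H
      intro u
      have : u ∈ Φ.range := by rw [ht]; trivial
      obtain ⟨⟨a, c⟩, rfl⟩ := this
      exact ⟨a, c, hΦ a c⟩
  · -- `T` is skew-adjoint
    rw [hk.neg_one_pow, neg_one_smul] at hTs
    obtain ⟨v, hv⟩ := h.exists_diag T _ hTadj hTs hT0
    let Φ : ℝ[X] →ₗ[ℝ] V := (LinearMap.applyₗ v).comp (aeval x).toLinearMap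
    have hΦ : ∀ f, Φ f = aeval x f v := fun f => by simp [Φ]
    have t0 : ∀ p : ℝ[X], ∀ u ∈ Φ.range, aeval x p u ∈ Φ.range := by
      rintro p _ ⟨f, rfl⟩
      exact ⟨p * f, by simp [hΦ]⟩
    have t1 : ∀ u ∈ Φ.range, x u ∈ Φ.range := by simpa using t0 X
    have t2 : ∀ u ∈ Φ.range, xi u ∈ Φ.range := by simpa [hP] using t0 P
    have hvm : v ∈ Φ.range := ⟨1, by simp [hΦ]⟩
    have t3 : ∀ u ∈ Φ.range, (∀ v ∈ Φ.range, ω u v = 0) → u = 0 := by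
      rintro _ ⟨a, rfl⟩ hh
      rw [hΦ]
      by_contra hne
      obtain ⟨r, hr⟩ := hr a (fun e => hne (by rw [e]; rfl))
      apply hv
      rw [← hr, map_mul, Module.End.mul_apply, h.adj, aeval_xi_eq hP, ← hΦ]
      exact hh _ (t0 _ v hvm)
    rcases hI Φ.range t1 t2 t3 with hb | ht
    · exfalso
      rw [hb, Submodule.mem_bot] at hvm
      apply hv
      rw [hvm]; simp
    · apply h.construct v 0
      · simp
      · intro u
        have : u ∈ Φ.range := by rw [ht]; trivial
        obtain ⟨a, rfl⟩ := this
        exact ⟨a, 0, by simp [hΦ]⟩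

theorem SD.indec_good [FiniteDimensional ℝ V] (h : SD ω x xi) (hI : Indec ω x xi) :
    Good ω x := by
  rcases subsingleton_or_nontrivial V with hV | hV
  · exact ⟨0, fun u v => by simp [Subsingleton.elim u 0], fun u => Subsingleton.elim _ _⟩
  obtain ⟨P, hP⟩ := h.exP
  have hP' : aeval xi P = x := by
    have := h.aeval_xi_comp hP X
    simpa using this
  have key : ∀ ε : ℝ, ε * ε = 1 → Good ω x ∨ Function.Injective (x - ε • 1 : Module.End ℝ V) := by
    intro ε hε
    have e1 : (aeval x (X + P - C (2 * ε)) : Module.End ℝ V)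
        = xi * (x - ε • 1) * (x - ε • 1) := by
      simp only [map_add, map_sub, aeval_X, hP, aeval_C, Algebra.algebraMap_eq_smul_one, mul_sub,
        h.mul2, sub_mul, mul_smul_comm, smul_mul_assoc, mul_one, one_mul]
      simp only [smul_sub, smul_smul, hε]
      module
    rcases h.fitting hI (X + P - C (2 * ε)) (by simp [hP, hP', add_comm]) with h1 | h1
    · right
      intro a b hab
      apply h1
      rw [e1, Module.End.mul_apply, Module.End.mul_apply, hab]
      simp
    · left
      apply h.case2 hI ε hε
      have e2 : (aeval x (X - C ε) : Module.End ℝ V) ^ 2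
          = aeval x (X : ℝ[X]) * aeval x (X + P - C (2 * ε)) := by
        rw [e1, aeval_X, map_sub, aeval_X, aeval_C, Algebra.algebraMap_eq_smul_one,
          ← mul_assoc, ← mul_assoc, h.mul1, one_mul, pow_two]
      have e3 : IsNilpotent ((aeval x (X - C ε) : Module.End ℝ V) ^ 2) := by
        have hc : Commute (aeval x (X : ℝ[X]) : Module.End ℝ V)
            (aeval x (X + P - C (2 * ε))) := by
          rw [Commute, SemiconjBy, ← map_mul, mul_comm, map_mul]
        rw [e2]
        exact hc.isNilpotent_mul_left h1
      obtain ⟨m, hm⟩ := e3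
      exact ⟨2 * m, by rw [pow_mul, hm]⟩
  rcases key 1 (by norm_num) with h1 | h1
  · exact h1
  rcases key (-1) (by norm_num) with h2 | h2
  · exact h2
  apply h.case1 hI
  rw [injective_iff_map_eq_zero]
  intro u hu
  apply h1.eq_iff' (map_zero _) |>.1
  apply h2.eq_iff' (map_zero _) |>.1
  have hu' : x u = xi u := by simpa [sub_eq_zero] using hu
  simp only [LinearMap.sub_apply, LinearMap.smul_apply, Module.End.one_apply, map_sub, one_smul,
    hu', h.x_xi]
  module

theorem SD.main (N : ℕ) : ∀ (V : Type) [AddCommGroup V] [Module ℝ V] [FiniteDimensional ℝ V]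
    (ω : V →ₗ[ℝ] V →ₗ[ℝ] ℝ) (x xi : Module.End ℝ V), SD ω x xi →
      Module.finrank ℝ V = N → Good ω x := by
  induction N using Nat.strong_induction_on with
  | _ N ih =>
    intro V _ _ _ ω x xi h hN
    by_cases hI : Indec ω x xi
    · exact h.indec_good hI
    · unfold Indec at hI
      push Not at hI
      obtain ⟨W, h1, h2, h3, hb, ht⟩ := hI
      refine h.split ?_ W h1 h2 h3 hb ht
      intro W _ _ _ ω' x' xi' h' hlt
      exact ih _ (hN ▸ hlt) W ω' x' xi' h' rfl

end MVW

/-- The MVW property for `Sp_{2n}(ℝ)`: every symplectic transformation is conjugated to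
its inverse by an anti-isometry of the symplectic form. -/
theorem symplectic_MVW (n : ℕ)
    (x : (((Fin n → ℝ) × (Fin n → ℝ)) →ₗ[ℝ] ((Fin n → ℝ) × (Fin n → ℝ)))ˣ)
    (hx : ∀ u v, stdSymplectic n ((x : _ →ₗ[ℝ] _) u) ((x : _ →ₗ[ℝ] _) v) =
      stdSymplectic n u v) :
    ∃ g : (((Fin n → ℝ) × (Fin n → ℝ)) →ₗ[ℝ] ((Fin n → ℝ) × (Fin n → ℝ)))ˣ,
      (∀ u v, stdSymplectic n ((g : _ →ₗ[ℝ] _) u) ((g : _ →ₗ[ℝ] _) v) =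
        stdSymplectic n v u) ∧
      g * x * g⁻¹ = x⁻¹ := by
  let ω : ((Fin n → ℝ) × (Fin n → ℝ)) →ₗ[ℝ] ((Fin n → ℝ) × (Fin n → ℝ)) →ₗ[ℝ] ℝ :=
    LinearMap.mk₂ ℝ (stdSymplectic n)
      (fun a b c => by
        simp only [stdSymplectic, ← Finset.sum_add_distrib]
        exact Finset.sum_congr rfl fun i _ => by simp; ring)
      (fun a b c => by
        simp only [stdSymplectic, smul_eq_mul, Finset.mul_sum]
        exact Finset.sum_congr rfl fun i _ => by simp; ring)
      (fun a b c => by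
        simp only [stdSymplectic, ← Finset.sum_add_distrib]
        exact Finset.sum_congr rfl fun i _ => by simp; ring)
      (fun a b c => by
        simp only [stdSymplectic, smul_eq_mul, Finset.mul_sum]
        exact Finset.sum_congr rfl fun i _ => by simp; ring)
  have hω : ∀ u v, ω u v = stdSymplectic n u v := fun u v => rfl
  have h : MVW.SD ω x.val x⁻¹.val :=
    { alt := fun u => by
        rw [hω, stdSymplectic]
        exact Finset.sum_eq_zero fun i _ => by ring
      nd := fun u hu => by
        apply Prod.ext
        · funext i
          have := hu (0, Pi.single i 1)
          simpa [hω, stdSymplectic, Pi.single_apply] using this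
        · funext i
          have := hu (Pi.single i 1, 0)
          simpa [hω, stdSymplectic, Pi.single_apply] using this
      mul1 := x.mul_inv
      mul2 := x.inv_mul
      iso := hx }
  obtain ⟨g, hg1, hg2⟩ := MVW.SD.main _ _ ω _ _ h rfl
  have hinj : Function.Injective g := by
    rw [injective_iff_map_eq_zero]
    intro u hu
    apply h.nd
    intro v
    have := hg1 u v
    rw [hu, map_zero, LinearMap.zero_apply] at this
    linarith
  have hunit : IsUnit (g : Module.End ℝ ((Fin n → ℝ) × (Fin n → ℝ))) :=
    (Module.End.isUnit_iff g).2 ⟨hinj, LinearMap.injective_iff_surjective.1 hinj⟩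
  obtain ⟨G, hG⟩ := hunit
  refine ⟨G, ?_, ?_⟩
  · intro u v
    have e : (G : Module.End ℝ ((Fin n → ℝ) × (Fin n → ℝ))) = g := hG
    rw [e, ← hω, ← hω, hg1, h.skew u v, neg_neg]
  · have e : x * (G * x) = G := by
      apply Units.ext
      rw [Units.val_mul, Units.val_mul, hG]
      exact LinearMap.ext hg2
    rw [mul_inv_eq_iff_eq_mul, eq_inv_mul_iff_mul_eq, e]
end
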